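/- arXiv:1102.2547 — 2 statements merged into one kernel-verified Lean document; each statement's English description precedes it below -/
import Mathlib

section
/- Let φ be an orientation of a finite graph Γ. The following are equivalent: (a) φ is totally cyclic; (b) for any two distinct vertices v, w lying in the same connected component of Γ there is an oriented path from w to v compatibly oriented with φ; (c) the classes [γ], for γ ∈ Cir_φ(Γ), generate the group H₁(Γ,ℤ), and Γ has no separating edges; (d) every edge of Γ lies in the edge set of some oriented circuit γ ∈ Cir_φ(Γ). -/
/-!
Serre-style finite graphs: a vertex type `V`, an oriented-edge type `E` with a
fixed-point-free involution `inv` (edge reversal) and source/target maps `s, t`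
with `s (inv e) = t e`.  An unoriented edge is an `inv`-orbit `{e, inv e}`;
subsets of unoriented edges are encoded as `inv`-closed subsets of `E`, and an
orientation of a spanning subgraph `Γ∖T` is encoded by the set `O` of its
positively oriented edges.  1-chains with coefficients in `A` are encoded as
functions `c : E → A` with `c (inv e) = - c e` (so that `(c, e⃗) = c e` for the
standard bilinear form).
-/

structure SerreGraph where
  V : Type
  E : Type
  [fintypeV : Fintype V]
  [fintypeE : Fintype E]
  [decEqV : DecidableEq V]
  [decEqE : DecidableEq E]
  inv : E → E
  s : E → V
  t : E → V
  inv_inv : ∀ e, inv (inv e) = e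
  inv_ne : ∀ e, inv e ≠ e
  s_inv : ∀ e, s (inv e) = t e

attribute [instance] SerreGraph.fintypeV SerreGraph.fintypeE
attribute [instance] SerreGraph.decEqV SerreGraph.decEqE

namespace SerreGraph

variable (Γ : SerreGraph)

/-- Reachability between vertices in the spanning subgraph whose allowed oriented
edges are those in `A`. -/
def Reach (A : Set Γ.E) : Γ.V → Γ.V → Prop :=
  Relation.ReflTransGen (fun a b => ∃ e ∈ A, Γ.s e = a ∧ Γ.t e = b)

/-- The number of connected components of the spanning subgraph with allowed
oriented edges `A`. -/
noncomputable def numComponents (A : Set Γ.E) : ℕ :=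
  Nat.card (Quot (fun a b : Γ.V => ∃ e ∈ A, Γ.s e = a ∧ Γ.t e = b))

/-- The set of separating (oriented) edges: removing the underlying unoriented
edge increases the number of connected components. -/
def Esep : Set Γ.E :=
  {e | Γ.numComponents Set.univ < Γ.numComponents {f | f ≠ e ∧ f ≠ Γ.inv e}}

/-- `T` encodes a set of unoriented edges. -/
def InvClosed (T : Set Γ.E) : Prop := ∀ e, e ∈ T ↔ Γ.inv e ∈ T

/-- `O` is (the set of positively oriented edges of) an orientation of `Γ∖T`. -/
def IsOrientation (T O : Set Γ.E) : Prop :=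
  (∀ e ∈ O, e ∉ T) ∧ ∀ e, e ∉ T → (e ∈ O ↔ Γ.inv e ∉ O)

/-- A totally cyclic orientation of `Γ∖T`: an orientation such that there is no
vertex set `W` which is nonempty and proper inside some connected component of
`Γ∖T` and such that all edges of `Γ∖T` crossing the boundary of `W` are oriented
out of `W` (this is the componentwise condition of the paper). -/
def IsTotallyCyclic (T O : Set Γ.E) : Prop :=
  Γ.IsOrientation T O ∧
    ¬ ∃ W : Set Γ.V, (∃ v ∈ W, ∃ w ∈ Wᶜ, Γ.Reach Tᶜ v w) ∧
        ∀ e ∈ O, Γ.t e ∈ W → Γ.s e ∈ W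

/-- `γ` is (the set of positively oriented edges of) an oriented circuit of `Γ`:
a cyclic subgraph (connected, first Betti number one, no separating edges)
together with a totally cyclic orientation; equivalently a directed cycle:
each incident vertex has exactly one outgoing and one incoming edge in `γ`,
and the support is connected. -/
def IsCircuit (γ : Finset Γ.E) : Prop :=
  γ.Nonempty ∧ (∀ e ∈ γ, Γ.inv e ∉ γ) ∧
    (∀ v ∈ γ.image Γ.s ∪ γ.image Γ.t, ∃! e, e ∈ γ ∧ Γ.s e = v) ∧
    (∀ v ∈ γ.image Γ.s ∪ γ.image Γ.t, ∃! e, e ∈ γ ∧ Γ.t e = v) ∧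
    ∀ e ∈ γ, ∀ f ∈ γ, Γ.Reach ((↑γ : Set Γ.E) ∪ Γ.inv '' ↑γ) (Γ.s e) (Γ.s f)

/-- The class `[γ] ∈ H₁(Γ,ℤ)` of an oriented circuit. -/
def circChainZ (γ : Finset Γ.E) : Γ.E → ℤ :=
  fun e => if e ∈ γ then 1 else if Γ.inv e ∈ γ then -1 else 0

/-- The class `[γ] ∈ H₁(Γ,ℝ)` of an oriented circuit. -/
noncomputable def circChainR (γ : Finset Γ.E) : Γ.E → ℝ :=
  fun e => (Γ.circChainZ γ e : ℝ)

/-- `Cir_φ(Γ∖T)`: oriented circuits of `Γ∖T` compatibly oriented with the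
orientation with positive edges `O`. -/
def Cir (T O : Set Γ.E) : Set (Finset Γ.E) :=
  {γ | Γ.IsCircuit γ ∧ (∀ e ∈ γ, e ∈ O) ∧ ∀ e ∈ γ, e ∉ T}

/-- `c` is a 1-cycle: a skew 1-chain with vanishing boundary, i.e. an element of
`H₁(Γ,A)`. -/
def IsCycle {A : Type*} [AddCommGroup A] (c : Γ.E → A) : Prop :=
  (∀ e, c (Γ.inv e) = - c e) ∧
    ∀ v, ∑ e ∈ Finset.univ.filter (fun e => Γ.t e = v), c e = 0

/-- An element of `H₁(Γ∖T, A) ⊆ H₁(Γ,A)`: a cycle supported on edges not in `T`. -/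
def IsCycleOn {A : Type*} [AddCommGroup A] (T : Set Γ.E) (c : Γ.E → A) : Prop :=
  Γ.IsCycle c ∧ ∀ e ∈ T, c e = 0

/-- The standard positive definite bilinear form on `C⃗₁(Γ,ℝ)`, for which
`(c, e⃗) = c e`. -/
noncomputable def pair (c c' : Γ.E → ℝ) : ℝ := (∑ e, c e * c' e) / 2

/-- The first Betti number `b₁(Γ) = dim_ℝ H₁(Γ,ℝ)`. -/
noncomputable def b1 : ℕ :=
  Module.finrank ℝ (Submodule.span ℝ {c : Γ.E → ℝ | Γ.IsCycle c})

/-- `b₁(Γ∖T) = dim_ℝ H₁(Γ∖T,ℝ)`. -/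
noncomputable def b1Sub (T : Set Γ.E) : ℕ :=
  Module.finrank ℝ (Submodule.span ℝ {c : Γ.E → ℝ | Γ.IsCycleOn T c})

/-- The cone `σ(T,φ) ⊆ H₁(Γ,ℝ)` of the cographic fan associated to a pair
`(T, O)` with `O` an orientation of `Γ∖T`. -/
def sigmaCone (T O : Set Γ.E) : Set (Γ.E → ℝ) :=
  {v | Γ.IsCycle v ∧ (∀ e ∈ O, 0 ≤ v e) ∧ ∀ e ∈ T, v e = 0}

/-- The poset `OP_Γ` of totally cyclic orientations: pairs `(T, O)` with `T` a
set of unoriented edges and `O` a totally cyclic orientation of `Γ∖T`. -/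
def OP : Set (Set Γ.E × Set Γ.E) :=
  {p | Γ.InvClosed p.1 ∧ Γ.IsTotallyCyclic p.1 p.2}

/-- The order on `OP_Γ`: `(T',φ') ≤ (T,φ)` iff `T' ⊇ T` and `φ'` is the
restriction of `φ`. -/
def OPle (p q : Set Γ.E × Set Γ.E) : Prop :=
  q.1 ⊆ p.1 ∧ p.2 = q.2 ∩ p.1ᶜ

/-- `H₁(Γ,ℤ)` viewed as the set of lattice points of `H₁(Γ,ℝ)`. -/
def H1Z : Set (Γ.E → ℝ) := {c | Γ.IsCycle c ∧ ∀ e, ∃ n : ℤ, c e = (n : ℝ)}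

/-- The Voronoi polytope `Vor_Γ ⊆ H₁(Γ,ℝ)`. -/
def voronoi : Set (Γ.E → ℝ) :=
  {v | Γ.IsCycle v ∧ ∀ l ∈ Γ.H1Z, Γ.pair v v ≤ Γ.pair (v - l) (v - l)}

/-- A (exposed) face of the Voronoi polytope. -/
def IsVorFace (F : Set (Γ.E → ℝ)) : Prop :=
  ∃ l : (Γ.E → ℝ) →ₗ[ℝ] ℝ, F = {v | v ∈ Γ.voronoi ∧ ∀ w ∈ Γ.voronoi, l w ≤ l v}

/-- The face `F(T,φ)` of the Voronoi polytope associated to `(T,O) ∈ OP_Γ`. -/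
def vorFace (T O : Set Γ.E) : Set (Γ.E → ℝ) :=
  {v | v ∈ Γ.voronoi ∧ ∀ γ ∈ Γ.Cir T O,
      Γ.pair v (Γ.circChainR γ) = Γ.pair (Γ.circChainR γ) (Γ.circChainR γ) / 2}

end SerreGraph


namespace SerreGraph

variable {Γ : SerreGraph}

theorem t_inv (e : Γ.E) : Γ.t (Γ.inv e) = Γ.s e := by
  rw [← Γ.s_inv, Γ.inv_inv]

theorem Reach.mono {A B : Set Γ.E} (h : A ⊆ B) {a b : Γ.V} (hab : Γ.Reach A a b) :
    Γ.Reach B a b :=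
  Relation.ReflTransGen.mono (fun _ _ ⟨e, he, h'⟩ => ⟨e, h he, h'⟩) _ _ hab

theorem Reach.symm {A : Set Γ.E} (hA : ∀ e ∈ A, Γ.inv e ∈ A) {a b : Γ.V}
    (h : Γ.Reach A a b) : Γ.Reach A b a := by
  induction h with
  | refl => exact Relation.ReflTransGen.refl
  | tail _ hbc ih =>
    obtain ⟨e, he, rfl, rfl⟩ := hbc
    exact Relation.ReflTransGen.head ⟨Γ.inv e, hA e he, Γ.s_inv e, t_inv e⟩ ih

theorem Reach.mem_of_mem {A : Set Γ.E} {W : Set Γ.V} (hW : ∀ e ∈ A, Γ.t e ∈ W → Γ.s e ∈ W)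
    {a b : Γ.V} (h : Γ.Reach A a b) (hb : b ∈ W) : a ∈ W := by
  induction h with
  | refl => exact hb
  | tail _ hbc ih =>
    obtain ⟨e, he, rfl, rfl⟩ := hbc
    exact ih (hW e he hb)

/-- If a reachability path leaves `W`, then some edge of the path leaves `W`. -/
theorem Reach.exists_edge {A : Set Γ.E} {W : Set Γ.V} {a b : Γ.V} (h : Γ.Reach A a b)
    (ha : a ∈ W) (hb : b ∉ W) : ∃ e ∈ A, Γ.s e ∈ W ∧ Γ.t e ∉ W := by
  by_contra! hcon
  exact h.mem_of_mem (W := Wᶜ) (fun e he ht hs => ht (hcon e he hs)) hb ha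

/-- The edges of `γ` are those of a vertex-simple directed path from `a` to `b`. -/
structure IsSimplePath (γ : Finset Γ.E) (a b : Γ.V) : Prop where
  s_inj : Set.InjOn Γ.s γ
  t_inj : Set.InjOn Γ.t γ
  mem_iff : ∀ v, (v ∈ γ.image Γ.s ∨ v = b) ↔ (v ∈ γ.image Γ.t ∨ v = a)
  target_notMem : b ∉ γ.image Γ.s
  source_notMem : a ∉ γ.image Γ.t
  reach : ∀ f ∈ γ, Γ.Reach γ a (Γ.s f)

theorem IsSimplePath.nil (a : Γ.V) : IsSimplePath (∅ : Finset Γ.E) a a where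
  s_inj := by simp
  t_inj := by simp
  mem_iff := by simp
  target_notMem := by simp
  source_notMem := by simp
  reach := by simp

theorem IsSimplePath.cons {γ : Finset Γ.E} {b : Γ.V} (f : Γ.E) (h : IsSimplePath γ (Γ.t f) b)
    (hs : Γ.s f ∉ γ.image Γ.s) (hb : Γ.s f ≠ b) : IsSimplePath (insert f γ) (Γ.s f) b := by
  have hvert : ¬ (Γ.s f ∈ γ.image Γ.t ∨ Γ.s f = Γ.t f) := by
    rw [← h.mem_iff]
    exact not_or.2 ⟨hs, hb⟩
  refine ⟨?_, ?_, ?_, ?_, ?_, ?_⟩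
  · rw [Finset.coe_insert, Set.injOn_insert (fun hf => hs (Finset.mem_image_of_mem _ hf))]
    exact ⟨h.s_inj, by simpa using hs⟩
  · rw [Finset.coe_insert,
      Set.injOn_insert (fun hf => h.source_notMem (Finset.mem_image_of_mem _ hf))]
    exact ⟨h.t_inj, by simpa using h.source_notMem⟩
  · intro v
    have := h.mem_iff v
    simp only [Finset.image_insert, Finset.mem_insert] at this ⊢
    tauto
  · rw [Finset.image_insert, Finset.mem_insert]
    exact not_or.2 ⟨hb.symm, h.target_notMem⟩
  · rw [Finset.image_insert, Finset.mem_insert]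
    tauto
  · intro g hg
    obtain rfl | hg := Finset.mem_insert.1 hg
    · exact Relation.ReflTransGen.refl
    · exact Relation.ReflTransGen.head ⟨f, by simp, rfl, rfl⟩
        ((h.reach g hg).mono (by simp))

/-- Loop erasure: reachable vertices are joined by a vertex-simple path. -/
theorem Reach.exists_isSimplePath {A : Set Γ.E} {a b : Γ.V} (h : Γ.Reach A a b) :
    ∃ γ : Finset Γ.E, (γ : Set Γ.E) ⊆ A ∧ IsSimplePath γ a b := by
  suffices H : ∃ S : Set Γ.V, a ∈ S ∧ b ∈ S ∧ ∀ x ∈ S, ∃ γ : Finset Γ.E, (γ : Set Γ.E) ⊆ A ∧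
      IsSimplePath γ x b ∧ ∀ f ∈ γ, Γ.s f ∈ S by
    obtain ⟨S, ha, -, hS⟩ := H
    obtain ⟨γ, hγ, hp, -⟩ := hS a ha
    exact ⟨γ, hγ, hp⟩
  induction h using Relation.ReflTransGen.head_induction_on with
  | refl =>
    refine ⟨{b}, rfl, rfl, ?_⟩
    rintro x rfl
    exact ⟨∅, by simp, .nil _, by simp⟩
  | head hac _ ih =>
    obtain ⟨f, hf, rfl, rfl⟩ := hac
    obtain ⟨S, hc, hb, hS⟩ := ih
    by_cases hfS : Γ.s f ∈ S
    · exact ⟨S, hfS, hb, hS⟩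
    refine ⟨insert (Γ.s f) S, by simp, by simp [hb], ?_⟩
    rintro x (rfl | hx)
    · obtain ⟨γ, hγ, hp, hs⟩ := hS _ hc
      refine ⟨insert f γ, ?_, hp.cons f ?_ ?_, ?_⟩
      · rw [Finset.coe_insert]
        exact Set.insert_subset hf hγ
      · intro hmem
        obtain ⟨g, hg, hgs⟩ := Finset.mem_image.1 hmem
        exact hfS (hgs ▸ hs g hg)
      · rintro rfl
        exact hfS hb
      · intro g hg
        obtain rfl | hg := Finset.mem_insert.1 hg
        · exact Or.inl rfl
        · exact Or.inr (hs g hg)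
    · obtain ⟨γ, hγ, hp, hs⟩ := hS x hx
      exact ⟨γ, hγ, hp, fun g hg => Or.inr (hs g hg)⟩

/-- A simple path from the target of `e` to its source closes up to a circuit. -/
theorem IsSimplePath.isCircuit {γ : Finset Γ.E} {e : Γ.E} (h : IsSimplePath γ (Γ.t e) (Γ.s e))
    (hinv : ∀ f ∈ insert e γ, Γ.inv f ∉ insert e γ) : Γ.IsCircuit (insert e γ) := by
  have hs : Set.InjOn Γ.s (insert e γ : Finset Γ.E) := by
    rw [Finset.coe_insert,
      Set.injOn_insert (fun hf => h.target_notMem (Finset.mem_image_of_mem _ hf))]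
    exact ⟨h.s_inj, by simpa using h.target_notMem⟩
  have ht : Set.InjOn Γ.t (insert e γ : Finset Γ.E) := by
    rw [Finset.coe_insert,
      Set.injOn_insert (fun hf => h.source_notMem (Finset.mem_image_of_mem _ hf))]
    exact ⟨h.t_inj, by simpa using h.source_notMem⟩
  have hst : (insert e γ).image Γ.s = (insert e γ).image Γ.t := by
    ext v
    have := h.mem_iff v
    simp only [Finset.image_insert, Finset.mem_insert] at this ⊢
    tauto
  have hreach : ∀ f ∈ insert e γ, Γ.Reach (insert e γ : Finset Γ.E) (Γ.s e) (Γ.s f) := by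
    intro f hf
    obtain rfl | hf := Finset.mem_insert.1 hf
    · exact Relation.ReflTransGen.refl
    · exact Relation.ReflTransGen.head ⟨e, by simp, rfl, rfl⟩ ((h.reach f hf).mono (by simp))
  refine ⟨by simp, hinv, ?_, ?_, ?_⟩
  · intro v hv
    rw [← hst, Finset.union_self] at hv
    obtain ⟨f, hf, rfl⟩ := Finset.mem_image.1 hv
    exact ⟨f, ⟨hf, rfl⟩, fun g hg => hs hg.1 hf hg.2⟩
  · intro v hv
    rw [hst, Finset.union_self] at hv
    obtain ⟨f, hf, rfl⟩ := Finset.mem_image.1 hv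
    exact ⟨f, ⟨hf, rfl⟩, fun g hg => ht hg.1 hf hg.2⟩
  · intro f hf g hg
    have hsymm : ∀ x ∈ ((insert e γ : Finset Γ.E) : Set Γ.E) ∪ Γ.inv '' (insert e γ : Finset Γ.E),
        Γ.inv x ∈ ((insert e γ : Finset Γ.E) : Set Γ.E) ∪ Γ.inv '' (insert e γ : Finset Γ.E) := by
      rintro x (hx | ⟨y, hy, rfl⟩)
      · exact Or.inr ⟨x, hx, rfl⟩
      · exact Or.inl (by rwa [Γ.inv_inv])
    exact (((hreach f hf).mono Set.subset_union_left).symm hsymm).trans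
      ((hreach g hg).mono Set.subset_union_left)

theorem exists_isCircuit_of_reach {A : Set Γ.E} (hA : ∀ f ∈ A, Γ.inv f ∉ A) {e : Γ.E}
    (he : e ∈ A) (h : Γ.Reach A (Γ.t e) (Γ.s e)) :
    ∃ γ : Finset Γ.E, Γ.IsCircuit γ ∧ (∀ f ∈ γ, f ∈ A) ∧ e ∈ γ := by
  obtain ⟨γ, hγ, hp⟩ := h.exists_isSimplePath
  have hsub : ∀ f ∈ insert e γ, f ∈ A := by
    intro f hf
    obtain rfl | hf := Finset.mem_insert.1 hf
    · exact he
    · exact hγ hf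
  exact ⟨insert e γ, hp.isCircuit fun f hf hf' => hA f (hsub f hf) (hsub _ hf'), hsub, by simp⟩

theorem circChainZ_eq {γ : Finset Γ.E} (hγ : ∀ e ∈ γ, Γ.inv e ∉ γ) (e : Γ.E) :
    Γ.circChainZ γ e = (if e ∈ γ then 1 else 0) - (if Γ.inv e ∈ γ then 1 else 0) := by
  have := hγ e
  unfold circChainZ
  split_ifs <;> simp_all

theorem circChainZ_inv {γ : Finset Γ.E} (hγ : ∀ e ∈ γ, Γ.inv e ∉ γ) (e : Γ.E) :
    Γ.circChainZ γ (Γ.inv e) = - Γ.circChainZ γ e := by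
  rw [circChainZ_eq hγ, circChainZ_eq hγ, Γ.inv_inv]
  ring

/-- The boundary of the chain `∑ e ∈ γ, e`. -/
theorem sum_circChainZ {γ : Finset Γ.E} (hγ : ∀ e ∈ γ, Γ.inv e ∉ γ) (v : Γ.V) :
    ∑ e ∈ Finset.univ.filter (fun e => Γ.t e = v), Γ.circChainZ γ e =
      ((γ.filter fun e => Γ.t e = v).card : ℤ) - (γ.filter fun e => Γ.s e = v).card := by
  simp only [circChainZ_eq hγ, Finset.sum_sub_distrib]
  congr 1
  · rw [Finset.sum_boole]
    congr 2
    ext e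
    simp [and_comm]
  · rw [Finset.sum_boole]
    congr 1
    refine Finset.card_bij' (fun e _ => Γ.inv e) (fun e _ => Γ.inv e) ?_ ?_ ?_ ?_
    · intro e he
      simp only [Finset.mem_filter, Finset.mem_univ, true_and, Γ.s_inv] at he ⊢
      exact ⟨he.2, he.1⟩
    · intro e he
      simp only [Finset.mem_filter, Finset.mem_univ, true_and, t_inv, Γ.inv_inv] at he ⊢
      exact ⟨he.2, he.1⟩
    · intro e _
      exact Γ.inv_inv e
    · intro e _
      exact Γ.inv_inv e

theorem IsCircuit.isCycle {γ : Finset Γ.E} (h : Γ.IsCircuit γ) : Γ.IsCycle (Γ.circChainZ γ) := by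
  obtain ⟨-, hinv, hs, ht, -⟩ := h
  refine ⟨circChainZ_inv hinv, fun v => ?_⟩
  rw [sum_circChainZ hinv, sub_eq_zero, Nat.cast_inj]
  by_cases hv : v ∈ γ.image Γ.s ∪ γ.image Γ.t
  · obtain ⟨e, he, he'⟩ := hs v hv
    obtain ⟨f, hf, hf'⟩ := ht v hv
    have h1 : (γ.filter fun e => Γ.s e = v) = {e} := by
      ext x
      simp only [Finset.mem_filter, Finset.mem_singleton]
      exact ⟨he' x, by rintro rfl; exact he⟩
    have h2 : (γ.filter fun e => Γ.t e = v) = {f} := by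
      ext x
      simp only [Finset.mem_filter, Finset.mem_singleton]
      exact ⟨hf' x, by rintro rfl; exact hf⟩
    rw [h1, h2, Finset.card_singleton, Finset.card_singleton]
  · have h1 : (γ.filter fun e => Γ.s e = v) = ∅ :=
      Finset.filter_eq_empty_iff.2 fun x hx hxv =>
        hv (Finset.mem_union_left _ (Finset.mem_image.2 ⟨x, hx, hxv⟩))
    have h2 : (γ.filter fun e => Γ.t e = v) = ∅ :=
      Finset.filter_eq_empty_iff.2 fun x hx hxv =>
        hv (Finset.mem_union_right _ (Finset.mem_image.2 ⟨x, hx, hxv⟩))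
    rw [h1, h2]

variable (Γ) in
/-- The group `H₁(Γ,ℤ)`. -/
def cycleSubgroup : AddSubgroup (Γ.E → ℤ) where
  carrier := {c | Γ.IsCycle c}
  zero_mem' := ⟨by simp, by simp⟩
  add_mem' {c d} hc hd := by
    refine ⟨fun e => ?_, fun v => ?_⟩
    · simp only [Pi.add_apply, hc.1, hd.1]
      ring
    · simp only [Pi.add_apply, Finset.sum_add_distrib, hc.2, hd.2, add_zero]
  neg_mem' {c} hc := by
    refine ⟨fun e => ?_, fun v => ?_⟩
    · simp only [Pi.neg_apply, hc.1]
    · simp only [Pi.neg_apply, Finset.sum_neg_distrib, hc.2, neg_zero]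

open Classical in
/-- The net flow of a cycle into a vertex set vanishes. -/
theorem IsCycle.sum_cut {c : Γ.E → ℤ} (hc : Γ.IsCycle c) (W : Set Γ.V) :
    ∑ e ∈ Finset.univ.filter (fun e => Γ.t e ∈ W ∧ Γ.s e ∉ W), c e = 0 := by
  have hall : ∑ e ∈ Finset.univ.filter (fun e => Γ.t e ∈ W), c e = 0 := by
    rw [← Finset.sum_fiberwise_of_maps_to (t := Finset.univ.filter (· ∈ W)) (g := Γ.t)
      (by simp)]
    refine Finset.sum_eq_zero fun v hv => ?_
    rw [← hc.2 v, Finset.filter_filter]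
    refine Finset.sum_congr ?_ fun _ _ => rfl
    ext e
    simp only [Finset.mem_filter, Finset.mem_univ, true_and] at hv ⊢
    exact ⟨fun h => h.2, fun h => ⟨h ▸ hv, h⟩⟩
  have hin : ∑ e ∈ Finset.univ.filter (fun e => Γ.t e ∈ W ∧ Γ.s e ∈ W), c e = 0 := by
    refine Finset.sum_involution (fun e _ => Γ.inv e) ?_ ?_ ?_ ?_
    · intro e _
      rw [hc.1, add_neg_cancel]
    · intro e _ _
      exact Γ.inv_ne e
    · intro e he
      simp only [Finset.mem_filter, Finset.mem_univ, true_and, t_inv, Γ.s_inv] at he ⊢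
      exact he.symm
    · intro e _
      exact Γ.inv_inv e
  rw [← Finset.sum_filter_add_sum_filter_not _ (fun e => Γ.s e ∈ W), Finset.filter_filter,
    Finset.filter_filter, hin, zero_add] at hall
  exact hall

theorem IsCycle.reach_of_pos {c : Γ.E → ℤ} (hc : Γ.IsCycle c) {e : Γ.E} (he : 0 < c e) :
    Γ.Reach {f | 0 < c f} (Γ.t e) (Γ.s e) := by
  classical
  by_contra hte
  let W : Set Γ.V := {x | Γ.Reach {f | 0 < c f} x (Γ.s e)}
  have hnonpos : ∀ f ∈ Finset.univ.filter (fun f => Γ.t f ∈ W ∧ Γ.s f ∉ W), c f ≤ 0 := by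
    intro f hf
    simp only [Finset.mem_filter, Finset.mem_univ, true_and] at hf
    by_contra! hpos
    exact hf.2 (Relation.ReflTransGen.head ⟨f, hpos, rfl, rfl⟩ hf.1)
  have hzero := (Finset.sum_eq_zero_iff_of_nonpos hnonpos).1 (hc.sum_cut W) (Γ.inv e) (by
    simp only [Finset.mem_filter, Finset.mem_univ, true_and, t_inv, Γ.s_inv]
    exact ⟨Relation.ReflTransGen.refl, hte⟩)
  rw [hc.1] at hzero
  lia

theorem IsCycle.exists_isCircuit {c : Γ.E → ℤ} (hc : Γ.IsCycle c) {e : Γ.E} (he : 0 < c e) :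
    ∃ γ : Finset Γ.E, Γ.IsCircuit γ ∧ (∀ f ∈ γ, 0 < c f) ∧ e ∈ γ := by
  refine exists_isCircuit_of_reach (A := {f | 0 < c f}) ?_ he (hc.reach_of_pos he)
  intro f hf hf'
  simp only [Set.mem_ofPred_eq, hc.1] at hf hf'
  lia

/-- A path carries a chain whose boundary is the difference of its endpoints. -/
theorem Reach.exists_chain {A : Set Γ.E} (hA : ∀ e ∈ A, Γ.inv e ∈ A) {a b : Γ.V}
    (h : Γ.Reach A a b) :
    ∃ p : Γ.E → ℤ, (∀ e, p (Γ.inv e) = - p e) ∧ (∀ e ∉ A, p e = 0) ∧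
      ∀ v, ∑ e ∈ Finset.univ.filter (fun e => Γ.t e = v), p e =
        (if b = v then 1 else 0) - (if a = v then 1 else 0) := by
  induction h with
  | refl => exact ⟨0, by simp, by simp, by simp⟩
  | tail _ hbc ih =>
    obtain ⟨f, hf, rfl, rfl⟩ := hbc
    obtain ⟨p, hskew, hsupp, hbd⟩ := ih
    have hinv : ∀ e ∈ ({f} : Finset Γ.E), Γ.inv e ∉ ({f} : Finset Γ.E) := by
      simp [Γ.inv_ne]
    refine ⟨p + Γ.circChainZ {f}, fun e => ?_, fun e he => ?_, fun v => ?_⟩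
    · rw [Pi.add_apply, Pi.add_apply, hskew, circChainZ_inv hinv]
      ring
    · have h1 : e ≠ f := by
        rintro rfl
        exact he hf
      have h2 : Γ.inv e ≠ f := by
        rintro rfl
        exact he (Γ.inv_inv e ▸ hA _ hf)
      simp [hsupp e he, circChainZ, h1, h2]
    · simp only [Pi.add_apply, Finset.sum_add_distrib, hbd, sum_circChainZ hinv,
        Finset.filter_singleton]
      split_ifs <;> simp

theorem quot_eq_iff_reach {A : Set Γ.E} (hA : ∀ e ∈ A, Γ.inv e ∈ A) {a b : Γ.V} :
    Quot.mk (fun a b : Γ.V => ∃ e ∈ A, Γ.s e = a ∧ Γ.t e = b) a = Quot.mk _ b ↔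
      Γ.Reach A a b := by
  constructor
  · intro h
    replace h := Quot.eqvGen_exact h
    induction h with
    | rel _ _ h => exact Relation.ReflTransGen.single h
    | refl _ => exact Relation.ReflTransGen.refl
    | symm _ _ _ ih => exact ih.symm hA
    | trans _ _ _ _ _ ih₁ ih₂ => exact ih₁.trans ih₂
  · intro h
    induction h with
    | refl => rfl
    | tail _ hbc ih => exact ih.trans (Quot.sound hbc)

theorem inv_mem_deleteEdge (e : Γ.E) :
    ∀ f ∈ {f | f ≠ e ∧ f ≠ Γ.inv e}, Γ.inv f ∈ {f | f ≠ e ∧ f ≠ Γ.inv e} := by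
  rintro f ⟨h1, h2⟩
  refine ⟨?_, ?_⟩
  · rintro rfl
    exact h2 (Γ.inv_inv f).symm
  · intro h
    exact h1 (by rw [← Γ.inv_inv f, h, Γ.inv_inv])

/-- An edge is separating iff deleting it disconnects its endpoints. -/
theorem mem_Esep_iff (e : Γ.E) :
    e ∈ Γ.Esep ↔ ¬ Γ.Reach {f | f ≠ e ∧ f ≠ Γ.inv e} (Γ.s e) (Γ.t e) := by
  classical
  have hA := inv_mem_deleteEdge e
  change Γ.numComponents _ < Γ.numComponents _ ↔ _
  unfold numComponents
  constructor
  · intro hlt hreach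
    refine hlt.not_ge ?_
    refine Nat.card_le_card_of_surjective
      (Quot.lift (Quot.mk (fun a b : Γ.V => ∃ f ∈ {f | f ≠ e ∧ f ≠ Γ.inv e},
        Γ.s f = a ∧ Γ.t f = b)) ?_) ?_
    · rintro _ _ ⟨f, -, rfl, rfl⟩
      rw [quot_eq_iff_reach hA]
      by_cases h1 : f = e
      · exact h1 ▸ hreach
      by_cases h2 : f = Γ.inv e
      · rw [h2, Γ.s_inv, t_inv]
        exact hreach.symm hA
      exact Relation.ReflTransGen.single ⟨f, ⟨h1, h2⟩, rfl, rfl⟩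
    · rintro ⟨v⟩
      exact ⟨Quot.mk _ v, rfl⟩
  · intro hreach
    have : Fintype (Quot fun a b : Γ.V => ∃ f ∈ {f | f ≠ e ∧ f ≠ Γ.inv e},
        Γ.s f = a ∧ Γ.t f = b) := Fintype.ofFinite _
    have : Fintype (Quot fun a b : Γ.V => ∃ f ∈ (Set.univ : Set Γ.E),
        Γ.s f = a ∧ Γ.t f = b) := Fintype.ofFinite _
    rw [Nat.card_eq_fintype_card, Nat.card_eq_fintype_card]
    refine Fintype.card_lt_of_surjective_not_injective
      (Quot.map id fun a b ⟨f, _, h⟩ => ⟨f, Set.mem_univ f, h⟩) ?_ ?_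
    · rintro ⟨v⟩
      exact ⟨Quot.mk _ v, rfl⟩
    · intro hinj
      refine hreach ((quot_eq_iff_reach hA).1 (hinj ?_))
      exact Quot.sound ⟨e, Set.mem_univ e, rfl, rfl⟩

/-- A nonseparating edge lies on a cycle. -/
theorem exists_isCycle_of_notMem_Esep {e : Γ.E} (he : e ∉ Γ.Esep) :
    ∃ c : Γ.E → ℤ, Γ.IsCycle c ∧ c e ≠ 0 := by
  rw [mem_Esep_iff, not_not] at he
  obtain ⟨p, hskew, hsupp, hbd⟩ :=
    (he.symm (inv_mem_deleteEdge e)).exists_chain (inv_mem_deleteEdge e)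
  have hinv : ∀ f ∈ ({e} : Finset Γ.E), Γ.inv f ∉ ({e} : Finset Γ.E) := by
    simp [Γ.inv_ne]
  refine ⟨p + Γ.circChainZ {e}, ⟨fun f => ?_, fun v => ?_⟩, ?_⟩
  · rw [Pi.add_apply, Pi.add_apply, hskew, circChainZ_inv hinv]
    ring
  · simp only [Pi.add_apply, Finset.sum_add_distrib, hbd, sum_circChainZ hinv,
      Finset.filter_singleton]
    split_ifs <;> simp
  · simp [hsupp e (by simp), circChainZ]

theorem IsOrientation.inv_notMem {O : Set Γ.E} (hO : Γ.IsOrientation ∅ O) {e : Γ.E}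
    (he : e ∈ O) : Γ.inv e ∉ O :=
  (hO.2 e (Set.notMem_empty e)).1 he

theorem IsOrientation.inv_mem {O : Set Γ.E} (hO : Γ.IsOrientation ∅ O) {e : Γ.E}
    (he : e ∉ O) : Γ.inv e ∈ O := by
  by_contra h
  exact he ((hO.2 e (Set.notMem_empty e)).2 h)

theorem mem_Cir_empty {O : Set Γ.E} {γ : Finset Γ.E} :
    γ ∈ Γ.Cir ∅ O ↔ Γ.IsCircuit γ ∧ ∀ e ∈ γ, e ∈ O := by
  simp [Cir]

theorem isTotallyCyclic_iff_reach {O : Set Γ.E} (hO : Γ.IsOrientation ∅ O) :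
    Γ.IsTotallyCyclic ∅ O ↔
      ∀ v w : Γ.V, v ≠ w → Γ.Reach Set.univ v w → Γ.Reach O w v := by
  simp only [IsTotallyCyclic, Set.compl_empty]
  constructor
  · rintro ⟨-, h⟩ v w - hvw
    by_contra hwv
    exact h ⟨{x | Γ.Reach O x v}, ⟨v, Relation.ReflTransGen.refl, w, hwv, hvw⟩,
      fun e he ht => Relation.ReflTransGen.head ⟨e, he, rfl, rfl⟩ ht⟩
  · refine fun h => ⟨hO, ?_⟩
    rintro ⟨W, ⟨v, hv, w, hw, hvw⟩, hW⟩
    exact hw ((h v w (fun hne => hw (hne ▸ hv)) hvw).mem_of_mem hW hv)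

theorem isTotallyCyclic_iff_exists_circuit {O : Set Γ.E} (hO : Γ.IsOrientation ∅ O) :
    Γ.IsTotallyCyclic ∅ O ↔ ∀ e : Γ.E, ∃ γ ∈ Γ.Cir ∅ O, e ∈ γ ∨ Γ.inv e ∈ γ := by
  constructor
  · intro h
    have hmem : ∀ e ∈ O, ∃ γ ∈ Γ.Cir ∅ O, e ∈ γ := by
      intro e he
      have hreach : Γ.Reach O (Γ.t e) (Γ.s e) := by
        by_cases hloop : Γ.s e = Γ.t e
        · rw [hloop]
          exact Relation.ReflTransGen.refl
        · exact (isTotallyCyclic_iff_reach hO).1 h _ _ hloop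
            (Relation.ReflTransGen.single ⟨e, Set.mem_univ e, rfl, rfl⟩)
      obtain ⟨γ, hγ, hsub, hγe⟩ :=
        exists_isCircuit_of_reach (fun f hf => hO.inv_notMem hf) he hreach
      exact ⟨γ, mem_Cir_empty.2 ⟨hγ, hsub⟩, hγe⟩
    intro e
    by_cases he : e ∈ O
    · obtain ⟨γ, hγ, hγe⟩ := hmem e he
      exact ⟨γ, hγ, Or.inl hγe⟩
    · obtain ⟨γ, hγ, hγe⟩ := hmem _ (hO.inv_mem he)
      exact ⟨γ, hγ, Or.inr hγe⟩
  · refine fun h => ⟨hO, ?_⟩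
    rintro ⟨W, ⟨v, hv, w, hw, hvw⟩, hW⟩
    obtain ⟨e, -, hs, ht⟩ := hvw.exists_edge hv hw
    have he : e ∈ O := by
      by_contra he
      have := hW _ (hO.inv_mem he)
      rw [t_inv, Γ.s_inv] at this
      exact ht (this hs)
    obtain ⟨γ, hγ, hγe⟩ := h e
    rw [mem_Cir_empty] at hγ
    have hγe : e ∈ γ := hγe.resolve_right fun h => hO.inv_notMem he (hγ.2 _ h)
    have hreach := hγ.1.isCycle.reach_of_pos (e := e) (by simp [circChainZ, hγe])
    refine ht (hreach.mem_of_mem (fun f hf => hW f (hγ.2 f ?_)) hs)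
    by_contra hfγ
    simp only [circChainZ, hfγ, if_false, Set.mem_ofPred_eq] at hf
    split_ifs at hf <;> lia

theorem closure_circuits_le_cycleSubgroup (O : Set Γ.E) :
    AddSubgroup.closure {c' | ∃ γ ∈ Γ.Cir ∅ O, c' = Γ.circChainZ γ} ≤ Γ.cycleSubgroup := by
  rw [AddSubgroup.closure_le]
  rintro _ ⟨γ, hγ, rfl⟩
  exact hγ.1.isCycle

/-- A cycle that is nonnegative on an orientation is a sum of compatible circuits. -/
theorem IsCycle.mem_closure_of_nonneg {O : Set Γ.E} (hO : Γ.IsOrientation ∅ O) {c : Γ.E → ℤ}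
    (hc : Γ.IsCycle c) (hpos : ∀ e ∈ O, 0 ≤ c e) :
    c ∈ AddSubgroup.closure {c' | ∃ γ ∈ Γ.Cir ∅ O, c' = Γ.circChainZ γ} := by
  classical
  obtain ⟨n, hn⟩ : ∃ n : ℕ, ∑ e ∈ Finset.univ.filter (· ∈ O), c e ≤ n :=
    ⟨_, Int.self_le_toNat _⟩
  induction n using Nat.strong_induction_on generalizing c with
  | _ n ih =>
    by_cases h : ∃ e ∈ O, 0 < c e
    · obtain ⟨e, he, hce⟩ := h
      obtain ⟨γ, hγ, hγpos, hγe⟩ := hc.exists_isCircuit hce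
      have hγO : ∀ f ∈ γ, f ∈ O := by
        intro f hf
        by_contra hfO
        have h1 := hpos _ (hO.inv_mem hfO)
        have h2 := hγpos f hf
        rw [hc.1] at h1
        lia
      have hγmem : Γ.circChainZ γ ∈
          AddSubgroup.closure {c' | ∃ γ ∈ Γ.Cir ∅ O, c' = Γ.circChainZ γ} :=
        AddSubgroup.subset_closure ⟨γ, mem_Cir_empty.2 ⟨hγ, hγO⟩, rfl⟩
      have hcirc : ∀ f ∈ O, Γ.circChainZ γ f = if f ∈ γ then 1 else 0 := by
        intro f hf
        have : Γ.inv f ∉ γ := fun h => hO.inv_notMem hf (hγO _ h)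
        simp [circChainZ, this]
      have hpos' : ∀ f ∈ O, 0 ≤ (c - Γ.circChainZ γ) f := by
        intro f hf
        have h1 := hpos f hf
        have h2 := hγpos f
        rw [Pi.sub_apply, hcirc f hf]
        split_ifs with hfγ
        · have := h2 hfγ
          lia
        · lia
      have hlt : ∑ f ∈ Finset.univ.filter (· ∈ O), (c - Γ.circChainZ γ) f <
          ∑ f ∈ Finset.univ.filter (· ∈ O), c f := by
        refine Finset.sum_lt_sum (fun f hf => ?_) ⟨e, by simpa using he, ?_⟩
        · rw [Pi.sub_apply, hcirc f (by simpa using hf)]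
          split_ifs <;> lia
        · rw [Pi.sub_apply, hcirc e he, if_pos hγe]
          lia
      have hnn : 0 ≤ ∑ f ∈ Finset.univ.filter (· ∈ O), (c - Γ.circChainZ γ) f :=
        Finset.sum_nonneg fun f hf => hpos' f (by simpa using hf)
      have hmem := ih (n - 1) (by lia)
        (Γ.cycleSubgroup.sub_mem hc hγ.isCycle) hpos' (by lia)
      simpa using add_mem hmem hγmem
    · push Not at h
      have hzero : ∀ e ∈ O, c e = 0 := fun e he => le_antisymm (h e he) (hpos e he)
      have : c = 0 := by
        funext e
        by_cases he : e ∈ O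
        · exact hzero e he
        · have := hzero _ (hO.inv_mem he)
          rwa [hc.1, neg_eq_zero] at this
      rw [this]
      exact zero_mem _

theorem IsCycle.mem_closure {O : Set Γ.E} (hO : Γ.IsOrientation ∅ O)
    (h : ∀ e : Γ.E, ∃ γ ∈ Γ.Cir ∅ O, e ∈ γ ∨ Γ.inv e ∈ γ) {c : Γ.E → ℤ} (hc : Γ.IsCycle c) :
    c ∈ AddSubgroup.closure {c' | ∃ γ ∈ Γ.Cir ∅ O, c' = Γ.circChainZ γ} := by
  choose γ hγ hγe using h
  have hnn : ∀ e, ∀ f ∈ O, 0 ≤ Γ.circChainZ (γ e) f := by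
    intro e f hf
    have : Γ.inv f ∉ γ e := fun h => hO.inv_notMem hf ((mem_Cir_empty.1 (hγ e)).2 _ h)
    simp only [circChainZ, this, if_false]
    split_ifs <;> lia
  have hone : ∀ f ∈ O, Γ.circChainZ (γ f) f = 1 := by
    intro f hf
    have : Γ.inv f ∉ γ f := fun h => hO.inv_notMem hf ((mem_Cir_empty.1 (hγ f)).2 _ h)
    simp [circChainZ, (hγe f).resolve_right this]
  let d : Γ.E → ℤ := ∑ e, |c e| • Γ.circChainZ (γ e)
  have hd : d ∈ AddSubgroup.closure {c' | ∃ γ ∈ Γ.Cir ∅ O, c' = Γ.circChainZ γ} := by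
    refine sum_mem fun e _ => zsmul_mem (AddSubgroup.subset_closure ?_) _
    exact ⟨γ e, hγ e, rfl⟩
  have hcd : c + d ∈ AddSubgroup.closure {c' | ∃ γ ∈ Γ.Cir ∅ O, c' = Γ.circChainZ γ} := by
    refine IsCycle.mem_closure_of_nonneg hO
      (Γ.cycleSubgroup.add_mem hc (closure_circuits_le_cycleSubgroup O hd)) fun f hf => ?_
    have hdf : |c f| ≤ d f := by
      have := Finset.single_le_sum (f := fun e => |c e| * Γ.circChainZ (γ e) f)
        (fun e _ => mul_nonneg (abs_nonneg (c e)) (hnn e f hf)) (Finset.mem_univ f)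
      simpa [d, hone f hf] using this
    have := neg_abs_le (c f)
    rw [Pi.add_apply]
    lia
  simpa using sub_mem hcd hd

theorem Esep_eq_empty {O : Set Γ.E} (h : Γ.IsTotallyCyclic ∅ O) : Γ.Esep = ∅ := by
  obtain ⟨hO, h⟩ := h
  rw [Set.compl_empty] at h
  refine Set.eq_empty_iff_forall_notMem.2 fun e he => ?_
  rw [mem_Esep_iff] at he
  have hA := inv_mem_deleteEdge e
  by_cases heO : e ∈ O
  · refine h ⟨{x | Γ.Reach {f | f ≠ e ∧ f ≠ Γ.inv e} (Γ.s e) x},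
      ⟨_, Relation.ReflTransGen.refl, Γ.t e, he,
        Relation.ReflTransGen.single ⟨e, Set.mem_univ e, rfl, rfl⟩⟩, fun f hf ht => ?_⟩
    by_cases h1 : f = e
    · exact absurd (h1 ▸ ht) he
    have h2 : f ≠ Γ.inv e := fun h2 => hO.inv_notMem heO (h2 ▸ hf)
    exact ht.trans (Reach.symm hA (Relation.ReflTransGen.single ⟨f, ⟨h1, h2⟩, rfl, rfl⟩))
  · refine h ⟨{x | Γ.Reach {f | f ≠ e ∧ f ≠ Γ.inv e} (Γ.t e) x},
      ⟨_, Relation.ReflTransGen.refl, Γ.s e, fun hr => he (Reach.symm hA hr),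
        Relation.ReflTransGen.single ⟨Γ.inv e, Set.mem_univ _, Γ.s_inv e, t_inv e⟩⟩,
      fun f hf ht => ?_⟩
    have h1 : f ≠ e := fun h1 => heO (h1 ▸ hf)
    by_cases h2 : f = Γ.inv e
    · rw [h2, t_inv] at ht
      exact absurd (Reach.symm hA ht) he
    exact ht.trans (Reach.symm hA (Relation.ReflTransGen.single ⟨f, ⟨h1, h2⟩, rfl, rfl⟩))

/-- If compatible circuits generate the cycles, every nonseparating edge is on one of them. -/
theorem exists_circuit_of_cycles_le_closure {O : Set Γ.E}
    (h : ∀ c : Γ.E → ℤ, Γ.IsCycle c →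
      c ∈ AddSubgroup.closure {c' | ∃ γ ∈ Γ.Cir ∅ O, c' = Γ.circChainZ γ})
    {e : Γ.E} (he : e ∉ Γ.Esep) : ∃ γ ∈ Γ.Cir ∅ O, e ∈ γ ∨ Γ.inv e ∈ γ := by
  by_contra! hcon
  obtain ⟨c, hc, hce⟩ := exists_isCycle_of_notMem_Esep he
  have hle : AddSubgroup.closure {c' | ∃ γ ∈ Γ.Cir ∅ O, c' = Γ.circChainZ γ} ≤
      (Pi.evalAddMonoidHom (fun _ : Γ.E => ℤ) e).ker := by
    rw [AddSubgroup.closure_le]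
    rintro _ ⟨γ, hγ, rfl⟩
    simp [AddMonoidHom.mem_ker, circChainZ, hcon γ hγ]
  exact hce (hle (h c hc))

end SerreGraph

/-- For an orientation `O` of a finite graph `Γ`, the following
are equivalent: (a) `O` is totally cyclic; (b) any two distinct vertices in the
same connected component are joined by a compatibly oriented path; (c) the
classes of compatibly oriented circuits generate `H₁(Γ,ℤ)` and `Γ` has no
separating edges; (d) every edge lies in a compatibly oriented circuit. -/
theorem stmt1 (Γ : SerreGraph) (O : Set Γ.E) (hO : Γ.IsOrientation ∅ O) :
    (Γ.IsTotallyCyclic ∅ O ↔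
      ∀ v w : Γ.V, v ≠ w → Γ.Reach Set.univ v w →
        Relation.ReflTransGen (fun a b => ∃ e ∈ O, Γ.s e = a ∧ Γ.t e = b) w v) ∧
    (Γ.IsTotallyCyclic ∅ O ↔
      ((∀ c : Γ.E → ℤ,
          (c ∈ AddSubgroup.closure {c' | ∃ γ ∈ Γ.Cir ∅ O, c' = Γ.circChainZ γ} ↔
            Γ.IsCycle c)) ∧
        Γ.Esep = ∅)) ∧
    (Γ.IsTotallyCyclic ∅ O ↔
      ∀ e : Γ.E, ∃ γ ∈ Γ.Cir ∅ O, e ∈ γ ∨ Γ.inv e ∈ γ) := by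
  refine ⟨SerreGraph.isTotallyCyclic_iff_reach hO, ⟨fun h => ⟨fun c => ⟨fun hc => ?_, fun hc => ?_⟩,
    SerreGraph.Esep_eq_empty h⟩, fun h => ?_⟩, SerreGraph.isTotallyCyclic_iff_exists_circuit hO⟩
  · exact SerreGraph.closure_circuits_le_cycleSubgroup O hc
  · exact hc.mem_closure hO ((SerreGraph.isTotallyCyclic_iff_exists_circuit hO).1 h)
  · refine (SerreGraph.isTotallyCyclic_iff_exists_circuit hO).2 fun e => ?_
    exact SerreGraph.exists_circuit_of_cycles_le_closure (fun c hc => (h.1 c).2 hc) (by simp [h.2])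
end

section
/- For every subset S ⊆ E and every orientation ψ of Γ∖S there exists a unique (T,φ) ∈ OP_Γ such that σ(S,ψ) = σ(T,φ); in particular the map (T,φ) ↦ σ(T,φ) is injective on OP_Γ. -/
namespace SerreGraph

variable {Γ : SerreGraph}

/-- The `1`-chain of a single oriented edge. -/
noncomputable def edgeChain (Γ : SerreGraph) (e : Γ.E) : Γ.E → ℝ :=
  fun f => (if f = e then 1 else 0) - (if f = Γ.inv e then 1 else 0)

theorem inv_eq_iff {e f : Γ.E} : Γ.inv f = e ↔ f = Γ.inv e := by
  constructor
  · rintro rfl; rw [Γ.inv_inv]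
  · rintro rfl; rw [Γ.inv_inv]

theorem edgeChain_inv (e f : Γ.E) : Γ.edgeChain e (Γ.inv f) = - Γ.edgeChain e f := by
  have h : Γ.inv f = Γ.inv e ↔ f = e := by rw [inv_eq_iff, Γ.inv_inv]
  simp only [edgeChain, h, inv_eq_iff]
  ring

theorem edgeChain_self (e : Γ.E) : Γ.edgeChain e e = 1 := by
  simp [edgeChain, (Γ.inv_ne e).symm]

theorem sum_edgeChain (e : Γ.E) (v : Γ.V) :
    ∑ f ∈ Finset.univ.filter (fun f => Γ.t f = v), Γ.edgeChain e f
      = (if v = Γ.t e then 1 else 0) - (if v = Γ.s e then 1 else 0) := by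
  simp only [edgeChain, Finset.sum_sub_distrib, Finset.sum_ite_eq', Finset.mem_filter,
    Finset.mem_univ, true_and, t_inv]
  simp only [eq_comm]

theorem edgeChain_nonneg {T O : Set Γ.E} (hO : Γ.IsOrientation T O) {e f : Γ.E}
    (he : e ∈ O) (hf : f ∈ O) : 0 ≤ Γ.edgeChain e f := by
  have hne : f ≠ Γ.inv e := by
    rintro rfl
    exact (hO.2 e (hO.1 e he)).1 he hf
  simp only [edgeChain, if_neg hne, sub_zero]
  split_ifs <;> norm_num

theorem edgeChain_eq_zero {T O : Set Γ.E} (hT : Γ.InvClosed T) (hO : Γ.IsOrientation T O)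
    {e f : Γ.E} (he : e ∈ O) (hf : f ∈ T) : Γ.edgeChain e f = 0 := by
  have h1 : f ≠ e := by
    rintro rfl
    exact hO.1 f he hf
  have h2 : f ≠ Γ.inv e := by
    rintro rfl
    exact hO.1 e he ((hT e).2 hf)
  simp [edgeChain, h1, h2]

/-- A directed path from `a` to `b` carries a compatible `1`-chain with boundary `b - a`. -/
theorem exists_chain_of_reach {T O : Set Γ.E} (hT : Γ.InvClosed T) (hO : Γ.IsOrientation T O)
    {a b : Γ.V} (h : Γ.Reach O a b) :
    ∃ c : Γ.E → ℝ, (∀ e, c (Γ.inv e) = - c e) ∧ (∀ e ∈ O, 0 ≤ c e) ∧ (∀ e ∈ T, c e = 0) ∧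
      ∀ v, ∑ e ∈ Finset.univ.filter (fun e => Γ.t e = v), c e
        = (if v = b then 1 else 0) - (if v = a then 1 else 0) := by
  induction h with
  | refl => exact ⟨0, by simp, by simp, by simp, by simp⟩
  | tail _ hstep ih =>
    obtain ⟨c, hskew, hnonneg, hzero, hbd⟩ := ih
    obtain ⟨e, he, rfl, rfl⟩ := hstep
    refine ⟨c + Γ.edgeChain e, fun f => ?_, fun f hf => ?_, fun f hf => ?_, fun v => ?_⟩
    · simp only [Pi.add_apply, hskew, edgeChain_inv]; ring
    · exact add_nonneg (hnonneg f hf) (edgeChain_nonneg hO he hf)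
    · simp [hzero f hf, edgeChain_eq_zero hT hO he hf]
    · simp only [Pi.add_apply, Finset.sum_add_distrib, hbd, sum_edgeChain]; ring

/-- In a totally cyclic orientation the source of each edge is reachable from its target. -/
theorem IsTotallyCyclic.reach {T O : Set Γ.E} (h : Γ.IsTotallyCyclic T O) {e : Γ.E}
    (he : e ∈ O) : Γ.Reach O (Γ.t e) (Γ.s e) := by
  by_contra hne
  refine h.2 ⟨{x | Γ.Reach O x (Γ.s e)}, ⟨Γ.s e, Relation.ReflTransGen.refl, Γ.t e, hne,
    Relation.ReflTransGen.single ⟨e, h.1.1 e he, rfl, rfl⟩⟩, fun f hf hr => ?_⟩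
  exact Relation.ReflTransGen.head ⟨f, hf, rfl, rfl⟩ hr

theorem IsTotallyCyclic.exists_pos {T O : Set Γ.E} (hT : Γ.InvClosed T)
    (h : Γ.IsTotallyCyclic T O) {e : Γ.E} (he : e ∈ O) : ∃ v ∈ Γ.sigmaCone T O, 0 < v e := by
  obtain ⟨c, hskew, hnonneg, hzero, hbd⟩ := exists_chain_of_reach hT h.1 (h.reach he)
  refine ⟨c + Γ.edgeChain e, ⟨⟨fun f => ?_, fun v => ?_⟩, fun f hf => ?_, fun f hf => ?_⟩, ?_⟩
  · simp only [Pi.add_apply, hskew, edgeChain_inv]; ring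
  · simp only [Pi.add_apply, Finset.sum_add_distrib, hbd, sum_edgeChain]; ring
  · exact add_nonneg (hnonneg f hf) (edgeChain_nonneg h.1 he hf)
  · simp [hzero f hf, edgeChain_eq_zero hT h.1 he hf]
  · have := hnonneg e he
    simp only [Pi.add_apply, edgeChain_self]
    linarith

theorem IsTotallyCyclic.mem_iff_forall_eq_zero {T O : Set Γ.E} (hT : Γ.InvClosed T)
    (h : Γ.IsTotallyCyclic T O) (e : Γ.E) : e ∈ T ↔ ∀ v ∈ Γ.sigmaCone T O, v e = 0 := by
  refine ⟨fun he v hv => hv.2.2 e he, fun hz => by_contra fun he => ?_⟩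
  by_cases heO : e ∈ O
  · obtain ⟨v, hv, hpos⟩ := h.exists_pos hT heO
    exact hpos.ne' (hz v hv)
  · have hi : Γ.inv e ∈ O := not_not.1 (mt (h.1.2 e he).2 heO)
    obtain ⟨v, hv, hpos⟩ := h.exists_pos hT hi
    rw [hv.1.1, hz v hv] at hpos
    simp at hpos

theorem IsTotallyCyclic.mem_iff_forall_nonneg {T O : Set Γ.E} (hT : Γ.InvClosed T)
    (h : Γ.IsTotallyCyclic T O) (e : Γ.E) :
    e ∈ O ↔ e ∉ T ∧ ∀ v ∈ Γ.sigmaCone T O, 0 ≤ v e := by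
  refine ⟨fun he => ⟨h.1.1 e he, fun v hv => hv.2.1 e he⟩, fun ⟨he, hz⟩ => ?_⟩
  by_contra heO
  have hi : Γ.inv e ∈ O := not_not.1 (mt (h.1.2 e he).2 heO)
  obtain ⟨v, hv, hpos⟩ := h.exists_pos hT hi
  rw [hv.1.1] at hpos
  linarith [hz v hv]

open Classical in
/-- The net flow of a cycle through the boundary of a vertex set vanishes. -/
theorem IsCycle.sum_cut_eq_zero {v : Γ.E → ℝ} (hv : Γ.IsCycle v) (W : Set Γ.V) :
    ∑ f, ((if Γ.s f ∈ W then v f else 0) - (if Γ.t f ∈ W then v f else 0)) = 0 := by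
  have ht : ∑ f, (if Γ.t f ∈ W then v f else 0) = 0 := by
    rw [← Finset.sum_fiberwise Finset.univ Γ.t]
    refine Finset.sum_eq_zero fun w _ => ?_
    rw [Finset.sum_congr rfl (g := fun f => if w ∈ W then v f else 0)
      (fun f hf => by rw [(Finset.mem_filter.1 hf).2])]
    split_ifs
    · exact hv.2 w
    · simp
  have hs : ∑ f, (if Γ.s f ∈ W then v f else 0) = 0 := by
    have hinv : Function.Involutive Γ.inv := Γ.inv_inv
    rw [← hinv.bijective.sum_comp]
    simp only [Γ.s_inv, hv.1]
    refine neg_eq_zero.1 (Eq.trans ?_ ht)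
    rw [← Finset.sum_neg_distrib]
    exact Finset.sum_congr rfl fun f _ => by split_ifs <;> simp
  rw [Finset.sum_sub_distrib, hs, ht, sub_zero]

/-- A vector of the cone vanishes on the boundary of a directed cut. -/
theorem eq_zero_of_cut {T O : Set Γ.E} (hO : Γ.IsOrientation T O) {W : Set Γ.V}
    (hW : ∀ e ∈ O, Γ.t e ∈ W → Γ.s e ∈ W) {v : Γ.E → ℝ} (hv : v ∈ Γ.sigmaCone T O)
    {e : Γ.E} (hs : Γ.s e ∈ W) (ht : Γ.t e ∉ W) : v e = 0 := by
  classical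
  have key := (Finset.sum_eq_zero_iff_of_nonneg (fun f _ => ?_)).1
    (hv.1.sum_cut_eq_zero W) e (Finset.mem_univ e)
  · simpa [hs, ht] using key
  · by_cases hfT : f ∈ T
    · simp [hv.2.2 f hfT]
    · by_cases hfO : f ∈ O
      · have := hv.2.1 f hfO
        have := hW f hfO
        split_ifs <;> simp_all
      · have hi : Γ.inv f ∈ O := not_not.1 (mt (hO.2 f hfT).2 hfO)
        have h1 := hv.2.1 _ hi
        have h2 := hW _ hi
        rw [hv.1.1] at h1
        rw [t_inv, Γ.s_inv] at h2
        split_ifs <;> simp_all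

/-- Removing the edges on which the whole cone vanishes leaves a totally cyclic orientation
with the same cone. -/
theorem exists_op_sigmaCone_eq {S ψ : Set Γ.E} (hψ : Γ.IsOrientation S ψ) :
    ∃ p ∈ Γ.OP, Γ.sigmaCone S ψ = Γ.sigmaCone p.1 p.2 := by
  set T : Set Γ.E := {e | ∀ v ∈ Γ.sigmaCone S ψ, v e = 0}
  have hST : S ⊆ T := fun e he v hv => hv.2.2 e he
  have hT : Γ.InvClosed T := fun e => by
    refine forall₂_congr fun v hv => ?_
    rw [hv.1.1, neg_eq_zero]
  have hO : Γ.IsOrientation T (ψ \ T) := by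
    refine ⟨fun e he => he.2, fun e he => ?_⟩
    have h1 := hψ.2 e (fun h => he (hST h))
    have h2 : Γ.inv e ∉ T := mt (hT e).2 he
    simp [h1, he, h2]
  have hcone : Γ.sigmaCone S ψ = Γ.sigmaCone T (ψ \ T) := by
    ext v
    refine ⟨fun hv => ⟨hv.1, fun e he => hv.2.1 e he.1, fun e he => he v hv⟩,
      fun hv => ⟨hv.1, fun e he => ?_, fun e he => hv.2.2 e (hST he)⟩⟩
    by_cases heT : e ∈ T
    · exact (hv.2.2 e heT).ge
    · exact hv.2.1 e ⟨he, heT⟩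
  refine ⟨(T, ψ \ T), ⟨hT, hO, ?_⟩, hcone⟩
  rintro ⟨W, ⟨a, ha, b, hb, hab⟩, hW⟩
  refine hb ?_
  clear hb
  induction hab with
  | refl => exact ha
  | tail _ hstep ih =>
    obtain ⟨e, he, rfl, rfl⟩ := hstep
    by_contra ht
    exact he fun v hv => eq_zero_of_cut hO hW (hcone ▸ hv) ih ht

theorem sigmaCone_injOn_op {p q : Set Γ.E × Set Γ.E} (hp : p ∈ Γ.OP) (hq : q ∈ Γ.OP)
    (h : Γ.sigmaCone p.1 p.2 = Γ.sigmaCone q.1 q.2) : p = q := by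
  have h1 : p.1 = q.1 := Set.ext fun e => by
    rw [hp.2.mem_iff_forall_eq_zero hp.1, hq.2.mem_iff_forall_eq_zero hq.1, h]
  refine Prod.ext h1 (Set.ext fun e => ?_)
  rw [hp.2.mem_iff_forall_nonneg hp.1, hq.2.mem_iff_forall_nonneg hq.1, h, h1]

end SerreGraph

/-- For every set of unoriented edges `S` and every orientation
`ψ` of `Γ∖S` there is a unique `(T,φ) ∈ OP_Γ` with `σ(S,ψ) = σ(T,φ)`; in
particular `(T,φ) ↦ σ(T,φ)` is injective on `OP_Γ`. -/
theorem stmt5 (Γ : SerreGraph) :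
    (∀ S : Set Γ.E, Γ.InvClosed S → ∀ ψ : Set Γ.E, Γ.IsOrientation S ψ →
      ∃ p ∈ Γ.OP, Γ.sigmaCone S ψ = Γ.sigmaCone p.1 p.2) ∧
    ∀ p ∈ Γ.OP, ∀ q ∈ Γ.OP,
      Γ.sigmaCone p.1 p.2 = Γ.sigmaCone q.1 q.2 → p = q := by
  exact ⟨fun _ _ _ hψ => SerreGraph.exists_op_sigmaCone_eq hψ,
    fun _ hp _ hq h => SerreGraph.sigmaCone_injOn_op hp hq h⟩
end
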